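/- Let d ≥ 1 and let ℙ be the i.i.d. Dirichlet environment on ℤ^d with parameters (β_1, …, β_{2d}). Then for β > 0, the ellipticity condition (E')_β is satisfied if and only if 2Σ_{i=1}^{2d} β_i − max_{1≤i≤d}(β_i + β_{i+d}) > β. -/

import Mathlib

open MeasureTheory Filter Topology
open scoped ENNReal NNReal Classical BigOperators

namespace RWRE

/-- Sites of the lattice `ℤ^d`. -/
abbrev V (d : ℕ) := Fin d → ℤ

/-- The `2d` canonical unit vectors: `dir d i = e_{i+1}` for `i < d`, and
`dir d i = -e_{i-d+1}` for `d ≤ i < 2d`. -/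
def dir (d : ℕ) (i : Fin (2 * d)) : V d :=
  fun j => if (j : ℕ) = (i : ℕ) ∨ (j : ℕ) + d = (i : ℕ) then (if (i : ℕ) < d then 1 else -1) else 0

/-- The index of the direction opposite to direction `i`. -/
def opp {d : ℕ} (i : Fin (2 * d)) : Fin (2 * d) :=
  ⟨if (i : ℕ) < d then (i : ℕ) + d else (i : ℕ) - d, by have := i.isLt; split <;> omega⟩

/-- The set `𝒫` of probability vectors on the `2d` directions. -/
abbrev Simplex (d : ℕ) := {p : Fin (2 * d) → ℝ // (∀ i, 0 ≤ p i) ∧ ∑ i, p i = 1}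

/-- The environment space `Ω = 𝒫^{ℤ^d}`. -/
abbrev Env (d : ℕ) := V d → Simplex d

/-- The space of trajectories of the walk. -/
abbrev Traj (d : ℕ) := ℕ → V d

/-- Transition probability of the walk from `y` to `z` in environment `ω`. -/
noncomputable def trans (d : ℕ) (ω : Env d) (y z : V d) : ℝ :=
  ∑ i : Fin (2 * d), if z = y + dir d i then (ω y).1 i else 0

/-- `Pq` is the family of quenched laws: `Pq ω x` is a probability measure on trajectories,
starting at `x`, whose cylinder probabilities are given by the products of the transition
probabilities of the environment `ω`. -/
def IsQuenchedLaw (d : ℕ) (Pq : Env d → V d → Measure (Traj d)) : Prop :=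
  (∀ ω x, IsProbabilityMeasure (Pq ω x)) ∧
  ∀ (ω : Env d) (x : V d) (n : ℕ) (σ : ℕ → V d),
    (Pq ω x {f | ∀ k ≤ n, f k = σ k}).toReal =
      (if σ 0 = x then 1 else 0) * ∏ k ∈ Finset.range n, trans d ω (σ k) (σ (k + 1))

/-- The annealed (averaged) law `P_x = ∫ P_{x,ω} dℙ`. -/
noncomputable def annealed (d : ℕ) (ℙ : Measure (Env d)) (Pq : Env d → V d → Measure (Traj d))
    (x : V d) : Measure (Traj d) :=
  ℙ.bind (fun ω => Pq ω x)

/-- `{ω(x) : x ∈ ℤ^d}` are i.i.d. under `ℙ`, with one-site marginal `μ`. -/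
def IsIIDWith (d : ℕ) (ℙ : Measure (Env d)) (μ : Measure (Simplex d)) : Prop :=
  IsProbabilityMeasure ℙ ∧ IsProbabilityMeasure μ ∧
  ∀ (s : Finset (V d)) (A : V d → Set (Simplex d)), (∀ x, MeasurableSet (A x)) →
    ℙ {ω | ∀ x ∈ s, ω x ∈ A x} = ∏ x ∈ s, μ (A x)

/-- `{ω(x) : x ∈ ℤ^d}` are i.i.d. under `ℙ`. -/
def IsIID (d : ℕ) (ℙ : Measure (Env d)) : Prop :=
  ∃ μ : Measure (Simplex d), IsIIDWith d ℙ μ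

/-- `ℙ` is elliptic. -/
def IsElliptic (d : ℕ) (ℙ : Measure (Env d)) : Prop :=
  ∀ (x : V d) (i : Fin (2 * d)), ℙ {ω | 0 < (ω x).1 i} = 1

/-- First exit time from a set `A` (with value `0` by convention if the walk never leaves `A`). -/
noncomputable def exitTime (d : ℕ) (A : Set (V d)) (f : Traj d) : ℕ :=
  sInf {n | f n ∉ A}

/-- The coordinates of a site, as a real vector. -/
def toR (d : ℕ) (x : V d) : Fin d → ℝ := fun j => (x j : ℝ)

/-- Euclidean inner product of a site with a real vector `l`. -/
noncomputable def dotl (d : ℕ) (l : Fin d → ℝ) (x : V d) : ℝ :=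
  ∑ j, (x j : ℝ) * l j

/-- The first canonical basis vector `e_1` of `ℝ^d`. -/
def e1 (d : ℕ) : Fin d → ℝ := fun j => if (j : ℕ) = 0 then 1 else 0

/-- `R` is a rotation of `ℝ^d`: a linear automorphism preserving the Euclidean inner
product, with determinant one. -/
def IsRotation (d : ℕ) (R : (Fin d → ℝ) ≃ₗ[ℝ] (Fin d → ℝ)) : Prop :=
  (∀ u v : Fin d → ℝ, ∑ j, R u j * R v j = ∑ j, u j * v j) ∧
    LinearMap.det (R : (Fin d → ℝ) →ₗ[ℝ] (Fin d → ℝ)) = 1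

/-- The box `B_{l,L,L̃} = R((-L,L) × (-L̃,L̃)^{d-1}) ∩ ℤ^d`, where `R` is a rotation
with `R e_1 = l`. -/
def box (d : ℕ) (R : (Fin d → ℝ) ≃ₗ[ℝ] (Fin d → ℝ)) (L Lt : ℝ) : Set (V d) :=
  {x | ∀ j : Fin d,
    if (j : ℕ) = 0 then -L < R.symm (toR d x) j ∧ R.symm (toR d x) j < L
    else -Lt < R.symm (toR d x) j ∧ R.symm (toR d x) j < Lt}

/-- The polynomial condition `(P)_M` in direction `l` on a box of size `L`. -/
def PolyCond (d : ℕ) (ℙ : Measure (Env d)) (Pq : Env d → V d → Measure (Traj d))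
    (l : Fin d → ℝ) (M L : ℝ) : Prop :=
  ∃ Lt : ℝ, 0 < Lt ∧ Lt ≤ 70 * L ^ 3 ∧
  ∃ R : (Fin d → ℝ) ≃ₗ[ℝ] (Fin d → ℝ), IsRotation d R ∧ R (e1 d) = l ∧
    ((annealed d ℙ Pq 0) {f | dotl d l (f (exitTime d (box d R L Lt) f)) < L}).toReal ≤ 1 / L ^ M

/-- The quantity `η_α = max_{e ∈ U} 𝔼[ω(0,e)^{-α}]`. -/
noncomputable def eta (d : ℕ) (ℙ : Measure (Env d)) (α : ℝ) : ℝ≥0∞ :=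
  ⨆ i : Fin (2 * d), ∫⁻ ω, ENNReal.ofReal ((ω 0).1 i ^ (-α)) ∂ℙ

/-- `ᾱ = sup{α ≥ 0 : η_α < ∞}`. -/
noncomputable def alphaBar (d : ℕ) (ℙ : Measure (Env d)) : ℝ :=
  sSup {α : ℝ | 0 ≤ α ∧ eta d ℙ α < ⊤}

/-- The constant `c_0 = (2/3)·3^{120d⁴ + 3000d(log η_{ᾱ/2})²}`. -/
noncomputable def c0 (d : ℕ) (ℙ : Measure (Env d)) : ℝ :=
  (2 / 3) * (3 : ℝ) ^ (120 * (d : ℝ) ^ 4 +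
    3000 * (d : ℝ) * (Real.log (eta d ℙ (alphaBar d ℙ / 2)).toReal) ^ 2)

/-- The ellipticity condition `(E')_β`. -/
def CondE (d : ℕ) (ℙ : Measure (Env d)) (β : ℝ) : Prop :=
  ∃ α : Fin (2 * d) → ℝ, (∀ i, 0 < α i) ∧
    (∀ i, 2 * (∑ j, α j) - (α i + α (opp i)) > β) ∧
    ∀ i : Fin (2 * d),
      ∫⁻ ω, ∏ j ∈ Finset.univ.erase i, ENNReal.ofReal ((ω 0).1 j ^ (-(α j))) ∂ℙ < ⊤


/-- First `n` with `P n`, as an extended natural number (`⊤` if there is none). -/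
noncomputable def firstTime (P : ℕ → Prop) : ℕ∞ :=
  if ∃ n, P n then ((sInf {n | P n} : ℕ) : ℕ∞) else ⊤

/-- The triple `(S_k, R_k, M_k)` of the regeneration construction in direction `l`
with parameter `a`. -/
noncomputable def SR (d : ℕ) (l : Fin d → ℝ) (a : ℝ) (f : Traj d) : ℕ → ℕ∞ × ℕ∞ × ℝ
  | 0 => (0, 0, dotl d l (f 0))
  | (k + 1) =>
      let M := (SR d l a f k).2.2
      let S : ℕ∞ := firstTime fun n => M + a ≤ dotl d l (f n)
      let s : ℕ := S.toNat
      let R : ℕ∞ := if S = ⊤ then ⊤ else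
        S + firstTime fun n => dotl d l (f (s + n)) < dotl d l (f s)
      let M' : ℝ := sSup {r : ℝ | ∃ n : ℕ, (n : ℕ∞) ≤ R ∧ r = dotl d l (f n)}
      (S, R, M')

/-- The first regeneration time `τ_1` in direction `l` with parameter `a`. -/
noncomputable def tau1 (d : ℕ) (l : Fin d → ℝ) (a : ℝ) (f : Traj d) : ℕ∞ :=
  if _h : ∃ k : ℕ, 1 ≤ k ∧ (SR d l a f k).1 ≠ ⊤ ∧ (SR d l a f k).2.1 = ⊤ then
    (SR d l a f (sInf {k : ℕ | 1 ≤ k ∧ (SR d l a f k).1 ≠ ⊤ ∧ (SR d l a f k).2.1 = ⊤})).1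
  else ⊤

/-- The event `τ_1 > u` for a real threshold `u`. -/
def tau1Gt (d : ℕ) (l : Fin d → ℝ) (a : ℝ) (u : ℝ) : Set (Traj d) :=
  {f | ∀ k : ℕ, tau1 d l a f = (k : ℕ∞) → u < (k : ℝ)}

/-- `v` is the asymptotic direction of the walk under the law `P0`:
`X_n/|X_n|₂ → v` almost surely. -/
def HasAsympDir (d : ℕ) (P0 : Measure (Traj d)) (v : Fin d → ℝ) : Prop :=
  ∀ᵐ f ∂P0, Tendsto
    (fun n => fun j : Fin d => (f n j : ℝ) / Real.sqrt (∑ j', ((f n j' : ℝ)) ^ 2))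
    atTop (𝓝 v)

/-- `γ` is the centered Gaussian measure on `ι → ℝ` with covariance matrix `C`:
every linear functional pushes it forward to a one-dimensional centered Gaussian with
the corresponding variance. -/
def IsCenteredGaussian {ι : Type*} [Fintype ι] (γ : Measure (ι → ℝ)) (C : ι → ι → ℝ) : Prop :=
  ∀ u : ι → ℝ, γ.map (fun x => ∑ i, u i * x i) =
    ProbabilityTheory.gaussianReal 0 (Real.toNNReal (∑ i, ∑ j, u i * C i j * u j))

/-- `ε^{1/2}(X_{⌊ε⁻¹n⌋} - ⌊ε⁻¹n⌋ v)` converges in law under `P0`, as `ε → 0`, to a Brownian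
motion with non-degenerate covariance matrix `C`: the finite-dimensional distributions at any
times `t : Fin k → ℕ` converge weakly to the centered Gaussian with covariance
`min(t_p, t_q)·C`. -/
def CLTtoBM (d : ℕ) (P0 : Measure (Traj d)) (v : Fin d → ℝ)
    (Cmat : Matrix (Fin d) (Fin d) ℝ) : Prop :=
  ∀ (k : ℕ) (t : Fin k → ℕ),
    ∃ γ : Measure (Fin k × Fin d → ℝ), IsProbabilityMeasure γ ∧
      IsCenteredGaussian γ (fun p q => (min (t p.1) (t q.1) : ℝ) * Cmat p.2 q.2) ∧
      ∀ g : BoundedContinuousFunction ((Fin k × Fin d) → ℝ) ℝ,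
        Tendsto (fun ε : ℝ =>
            ∫ f : Traj d, g (fun p =>
              Real.sqrt ε * ((f (⌊(t p.1 : ℝ) / ε⌋₊) p.2 : ℝ) - (⌊(t p.1 : ℝ) / ε⌋₊ : ℝ) * v p.2))
              ∂P0)
          (𝓝[>] (0 : ℝ)) (𝓝 (∫ x, g x ∂γ))

/-- `μ` is the Dirichlet distribution with parameters `β` on the simplex, characterized by
its (joint polynomial) moments. -/
def IsDirichlet (d : ℕ) (μ : Measure (Simplex d)) (β : Fin (2 * d) → ℝ) : Prop :=
  IsProbabilityMeasure μ ∧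
  ∀ k : Fin (2 * d) → ℕ,
    ∫ p, ∏ i, (p.1 i) ^ (k i) ∂μ =
      (Real.Gamma (∑ i, β i) / Real.Gamma ((∑ i, β i) + (∑ i, (k i : ℝ)))) *
        ∏ i, (Real.Gamma (β i + k i) / Real.Gamma (β i))

/-! ### Directed graph structure on `ℤ^d` and flows -/

/-- Directed nearest-neighbour edges of `ℤ^d`: the pair `(z, i)` represents the edge from
`z` to `z + dir d i`. -/
abbrev Edge (d : ℕ) := V d × Fin (2 * d)

def tail (d : ℕ) (e : Edge d) : V d := e.1

def head (d : ℕ) (e : Edge d) : V d := e.1 + dir d e.2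

/-- Divergence of an edge function at a vertex. -/
noncomputable def divg (d : ℕ) (θ : Edge d → ℝ) (v : V d) : ℝ :=
  (∑ᶠ e ∈ {e : Edge d | tail d e = v}, θ e) - ∑ᶠ e ∈ {e : Edge d | head d e = v}, θ e

/-- `θ` is a flow from `A` to `Z` on the directed graph `(ℤ^d, E_{ℤ^d})`. -/
def IsFlow (d : ℕ) (θ : Edge d → ℝ) (A Z : Set (V d)) : Prop :=
  (∀ e, 0 ≤ θ e) ∧ (∀ v, v ∉ A ∪ Z → divg d θ v = 0) ∧
    (∀ v ∈ A, 0 ≤ divg d θ v) ∧ (∀ v ∈ Z, divg d θ v ≤ 0)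

/-- `θ` is a unit flow from `A` to `Z`. -/
def IsUnitFlow (d : ℕ) (θ : Edge d → ℝ) (A Z : Set (V d)) : Prop :=
  IsFlow d θ A Z ∧ ∑ᶠ v ∈ A, divg d θ v = 1

/-- Two finite measures on `ℝ` carried by `[0,1]` with the same moments are equal. -/
lemma ext_of_moments (ρ η : Measure ℝ) [IsFiniteMeasure ρ] [IsFiniteMeasure η]
    (hρ : ∀ᵐ x ∂ρ, x ∈ Set.Icc (0:ℝ) 1) (hη : ∀ᵐ x ∂η, x ∈ Set.Icc (0:ℝ) 1)
    (h : ∀ k : ℕ, ∫ x, x ^ k ∂ρ = ∫ x, x ^ k ∂η) : ρ = η := by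
  have hint : ∀ (m : Measure ℝ) [IsFiniteMeasure m], (∀ᵐ x ∂m, x ∈ Set.Icc (0:ℝ) 1) →
      ∀ k : ℕ, Integrable (fun x : ℝ => x ^ k) m := by
    intro m _ hm k
    refine Integrable.of_bound (by fun_prop) 1 ?_
    filter_upwards [hm] with x hx
    rw [Real.norm_eq_abs, abs_of_nonneg (pow_nonneg hx.1 _)]
    exact pow_le_one₀ hx.1 hx.2
  have hpint : ∀ (m : Measure ℝ) [IsFiniteMeasure m], (∀ᵐ x ∂m, x ∈ Set.Icc (0:ℝ) 1) →
      ∀ p : Polynomial ℝ, Integrable (fun x : ℝ => p.eval x) m := by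
    intro m _ hm p
    simp only [Polynomial.eval_eq_sum_range]
    exact integrable_finsetSum _ fun i _ => (hint m hm i).const_mul _
  have hp : ∀ p : Polynomial ℝ, ∫ x, p.eval x ∂ρ = ∫ x, p.eval x ∂η := by
    intro p
    simp only [Polynomial.eval_eq_sum_range]
    rw [integral_finsetSum _ fun i _ => (hint ρ hρ i).const_mul _,
      integral_finsetSum _ fun i _ => (hint η hη i).const_mul _]
    simp only [integral_const_mul, h]
  have happ : ∀ (m : Measure ℝ) [IsFiniteMeasure m], (∀ᵐ x ∂m, x ∈ Set.Icc (0:ℝ) 1) →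
      ∀ (g : BoundedContinuousFunction ℝ ℝ) (p : Polynomial ℝ) (ε : ℝ),
      (∀ x ∈ Set.Icc (0:ℝ) 1, |p.eval x - g x| < ε) →
      |∫ x, p.eval x ∂m - ∫ x, g x ∂m| ≤ ε * m.real Set.univ := by
    intro m _ hm g p ε hp
    rw [← integral_sub (hpint m hm p) (g.integrable m), ← Real.norm_eq_abs]
    refine norm_integral_le_of_norm_le_const ?_
    filter_upwards [hm] with x hx
    exact (hp x hx).le
  refine ext_of_forall_integral_eq_of_IsFiniteMeasure fun g => ?_
  by_contra hne
  set δ := |∫ x, g x ∂ρ - ∫ x, g x ∂η| with hδ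
  have hδpos : 0 < δ := abs_pos.2 (sub_ne_zero.2 hne)
  set M := ρ.real Set.univ + η.real Set.univ + 1 with hM
  have h1 : 0 ≤ ρ.real Set.univ := measureReal_nonneg
  have h2 : 0 ≤ η.real Set.univ := measureReal_nonneg
  have hMpos : 0 < M := by positivity
  obtain ⟨p, hpε⟩ := exists_polynomial_near_of_continuousOn 0 1 g g.continuous.continuousOn
    (δ / M) (by positivity)
  have e1 := happ ρ hρ g p _ hpε
  have e2 := happ η hη g p _ hpε
  rw [hp p] at e1
  have e3 : δ ≤ δ / M * ρ.real Set.univ + δ / M * η.real Set.univ := by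
    have : ∫ x, g x ∂ρ - ∫ x, g x ∂η =
      (∫ x, p.eval x ∂η - ∫ x, g x ∂η) - (∫ x, p.eval x ∂η - ∫ x, g x ∂ρ) := by ring
    have e5 : δ ≤ |∫ x, p.eval x ∂η - ∫ x, g x ∂η| + |∫ x, p.eval x ∂η - ∫ x, g x ∂ρ| := by
      rw [hδ, this]
      exact abs_sub _ _
    linarith
  have e4 : δ = δ / M * ρ.real Set.univ + δ / M * η.real Set.univ + δ / M := by
    rw [← mul_add, ← mul_add_one, ← hM]; field_simp
  have : 0 < δ / M := by positivity
  linarith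

lemma beta_moment (a c s : ℝ) (ha : 0 < a) (hc : 0 < c) (hs : 0 < a + s) :
    ∫⁻ x, ENNReal.ofReal (x ^ s) ∂(ProbabilityTheory.betaMeasure a c) =
      ENNReal.ofReal (Real.Gamma (a + c) / Real.Gamma a *
        (Real.Gamma (a + s) / Real.Gamma (a + c + s))) := by
  have hG1 := Real.Gamma_pos_of_pos ha
  have hG2 := Real.Gamma_pos_of_pos hc
  have hG3 := Real.Gamma_pos_of_pos hs
  have hG4 := Real.Gamma_pos_of_pos (add_pos ha hc)
  have hG5 : 0 < Real.Gamma (a + c + s) := Real.Gamma_pos_of_pos (by linarith)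
  have hmeas : ∀ a c : ℝ, Measurable (ProbabilityTheory.betaPDF a c) := fun a c =>
    (ProbabilityTheory.measurable_betaPDFReal a c).ennreal_ofReal
  rw [ProbabilityTheory.betaMeasure, lintegral_withDensity_eq_lintegral_mul _ (hmeas a c)
    (by fun_prop)]
  have : ∀ x : ℝ, (ProbabilityTheory.betaPDF a c * fun x => ENNReal.ofReal (x ^ s)) x =
      ENNReal.ofReal (Real.Gamma (a + c) / Real.Gamma a *
        (Real.Gamma (a + s) / Real.Gamma (a + c + s))) *
        ProbabilityTheory.betaPDF (a + s) c x := by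
    intro x
    simp only [Pi.mul_apply, ProbabilityTheory.betaPDF_eq]
    split_ifs with hx
    · rw [← ENNReal.ofReal_mul, ← ENNReal.ofReal_mul (by positivity)]
      · congr 1
        have : x ^ (a + s - 1) = x ^ (a - 1) * x ^ s := by
          rw [← Real.rpow_add hx.1]; congr 1; ring
        rw [this, ProbabilityTheory.beta, ProbabilityTheory.beta,
          show a + s + c = a + c + s by ring]
        field_simp
      · have := ProbabilityTheory.betaPDFReal_pos hx.1 hx.2 ha hc
        rw [ProbabilityTheory.betaPDFReal, if_pos hx] at this
        exact this.le
    · simp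
  simp only [this]
  rw [lintegral_const_mul _ (hmeas _ _), ProbabilityTheory.lintegral_betaPDF_eq_one hs hc, mul_one]

lemma beta_supp (a c : ℝ) :
    ∀ᵐ x ∂(ProbabilityTheory.betaMeasure a c), 0 < x ∧ x < 1 := by
  have hmeas : Measurable (ProbabilityTheory.betaPDF a c) :=
    (ProbabilityTheory.measurable_betaPDFReal a c).ennreal_ofReal
  rw [ProbabilityTheory.betaMeasure, ae_withDensity_iff hmeas]
  refine ae_of_all _ fun x hx => ?_
  by_contra h
  exact hx (by rw [ProbabilityTheory.betaPDF_eq, if_neg h]; simp)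

lemma one_dim {X : Type*} [MeasurableSpace X] (ν : Measure X) (f : X → ℝ) (hf : Measurable f)
    (hf0 : ∀ x, 0 ≤ f x) (hf1 : ∀ x, f x ≤ 1) (a c C : ℝ) (ha : 0 < a) (hc : 0 < c) (hC : 0 < C)
    (h : ∀ k : ℕ, ∫⁻ x, ENNReal.ofReal (f x ^ (k:ℝ)) ∂ν =
      ENNReal.ofReal (C * (Real.Gamma (a + k) / Real.Gamma (a + c + k)))) :
    ν.map f = ENNReal.ofReal (C * Real.Gamma a / Real.Gamma (a + c)) •
      ProbabilityTheory.betaMeasure a c := by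
  have hG1 := Real.Gamma_pos_of_pos ha
  have hG4 := Real.Gamma_pos_of_pos (add_pos ha hc)
  have hfin : IsFiniteMeasure ν := by
    constructor
    have := h 0
    simp only [Nat.cast_zero, Real.rpow_zero, ENNReal.ofReal_one, lintegral_one] at this
    rw [this]; exact ENNReal.ofReal_lt_top
  have := ProbabilityTheory.isProbabilityMeasureBeta ha hc
  have : IsFiniteMeasure (ENNReal.ofReal (C * Real.Gamma a / Real.Gamma (a + c)) •
      ProbabilityTheory.betaMeasure a c) := Measure.smul_finite _ ENNReal.ofReal_ne_top
  have hs1 : ∀ᵐ x ∂(ν.map f), x ∈ Set.Icc (0:ℝ) 1 := by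
    refine (ae_map_iff hf.aemeasurable (p := fun x => x ∈ Set.Icc (0:ℝ) 1) measurableSet_Icc).2 ?_
    exact ae_of_all _ fun x => ⟨hf0 x, hf1 x⟩
  have hs2 : ∀ᵐ x ∂(ENNReal.ofReal (C * Real.Gamma a / Real.Gamma (a + c)) •
      ProbabilityTheory.betaMeasure a c), x ∈ Set.Icc (0:ℝ) 1 := by
    refine Measure.ae_smul_measure ?_ _
    filter_upwards [beta_supp a c] with x hx
    exact ⟨hx.1.le, hx.2.le⟩
  refine ext_of_moments _ _ hs1 hs2 fun k => ?_
  rw [integral_eq_lintegral_of_nonneg_ae _ (by fun_prop),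
    integral_eq_lintegral_of_nonneg_ae _ (by fun_prop)]
  · congr 1
    rw [lintegral_map (by fun_prop) hf, lintegral_smul_measure]
    have h1 := h k
    have h2 := beta_moment a c k ha hc (by positivity)
    simp only [Real.rpow_natCast] at h1 h2
    rw [h1, h2, smul_eq_mul, ← ENNReal.ofReal_mul (by positivity)]
    congr 1
    field_simp
  · filter_upwards [hs2] with x hx using pow_nonneg hx.1 _
  · filter_upwards [hs1] with x hx using pow_nonneg hx.1 _

lemma one_dim_pos {X : Type*} [MeasurableSpace X] (ν : Measure X) (f : X → ℝ) (hf : Measurable f)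
    (hf0 : ∀ x, 0 ≤ f x) (hf1 : ∀ x, f x ≤ 1) (a c C : ℝ) (ha : 0 < a) (hc : 0 < c) (hC : 0 < C)
    (h : ∀ k : ℕ, ∫⁻ x, ENNReal.ofReal (f x ^ (k:ℝ)) ∂ν =
      ENNReal.ofReal (C * (Real.Gamma (a + k) / Real.Gamma (a + c + k)))) :
    ∀ᵐ x ∂ν, 0 < f x := by
  have h1 := one_dim ν f hf hf0 hf1 a c C ha hc hC h
  have h2 : ∀ᵐ x ∂(ν.map f), 0 < x := by
    rw [h1]
    refine Measure.ae_smul_measure ?_ _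
    filter_upwards [beta_supp a c] with x hx using hx.1
  exact ae_of_ae_map hf.aemeasurable h2

lemma one_dim_moment {X : Type*} [MeasurableSpace X] (ν : Measure X) (f : X → ℝ)
    (hf : Measurable f)
    (hf0 : ∀ x, 0 ≤ f x) (hf1 : ∀ x, f x ≤ 1) (a c C : ℝ) (ha : 0 < a) (hc : 0 < c) (hC : 0 < C)
    (h : ∀ k : ℕ, ∫⁻ x, ENNReal.ofReal (f x ^ (k:ℝ)) ∂ν =
      ENNReal.ofReal (C * (Real.Gamma (a + k) / Real.Gamma (a + c + k))))
    (s : ℝ) (hs : 0 < a + s) :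
    ∫⁻ x, ENNReal.ofReal (f x ^ s) ∂ν =
      ENNReal.ofReal (C * (Real.Gamma (a + s) / Real.Gamma (a + c + s))) := by
  have hG1 := Real.Gamma_pos_of_pos ha
  have hG4 := Real.Gamma_pos_of_pos (add_pos ha hc)
  have h1 := one_dim ν f hf hf0 hf1 a c C ha hc hC h
  rw [← lintegral_map (f := fun x => ENNReal.ofReal (x ^ s)) (by fun_prop) hf, h1,
    lintegral_smul_measure, beta_moment a c s ha hc hs, smul_eq_mul,
    ← ENNReal.ofReal_mul (by positivity)]
  congr 1
  field_simp

lemma one_dim_lt {X : Type*} [MeasurableSpace X] (ν : Measure X) (f : X → ℝ)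
    (hf : Measurable f)
    (hf0 : ∀ x, 0 ≤ f x) (hf1 : ∀ x, f x ≤ 1) (a c C : ℝ) (ha : 0 < a) (hc : 0 < c) (hC : 0 < C)
    (h : ∀ k : ℕ, ∫⁻ x, ENNReal.ofReal (f x ^ (k:ℝ)) ∂ν =
      ENNReal.ofReal (C * (Real.Gamma (a + k) / Real.Gamma (a + c + k))))
    (s : ℝ) (hfin : ∫⁻ x, ENNReal.ofReal (f x ^ s) ∂ν < ⊤) : 0 < a + s := by
  by_contra hs
  push Not at hs
  set L := (∫⁻ x, ENNReal.ofReal (f x ^ s) ∂ν).toReal with hL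
  have hpos := one_dim_pos ν f hf hf0 hf1 a c C ha hc hC h
  have key : ∀ ε : ℝ, 0 < ε → C * Real.Gamma (ε + 1) ≤ L * ε * Real.Gamma (c + ε) := by
    intro ε hε
    have hG := Real.Gamma_pos_of_pos hε
    have hG' := Real.Gamma_pos_of_pos (add_pos hc hε)
    have h1 := one_dim_moment ν f hf hf0 hf1 a c C ha hc hC h (ε - a) (by linarith)
    have h2 : ∫⁻ x, ENNReal.ofReal (f x ^ (ε - a)) ∂ν ≤ ∫⁻ x, ENNReal.ofReal (f x ^ s) ∂ν := by
      refine lintegral_mono_ae ?_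
      filter_upwards [hpos] with x hx
      exact ENNReal.ofReal_le_ofReal (Real.rpow_le_rpow_of_exponent_ge hx (hf1 x) (by linarith))
    rw [h1, show a + (ε - a) = ε by ring, show a + c + (ε - a) = c + ε by ring] at h2
    have h3 := ENNReal.toReal_mono hfin.ne h2
    rw [ENNReal.toReal_ofReal (by positivity), ← hL, ← mul_div_assoc, div_le_iff₀ hG'] at h3
    rw [Real.Gamma_add_one hε.ne']
    nlinarith
  have cont : ∀ z : ℝ, 0 < z → ContinuousAt Real.Gamma z := fun z hz =>
    (Real.differentiableAt_Gamma fun m => by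
      have : (0:ℝ) ≤ m := m.cast_nonneg
      linarith).continuousAt
  have t1 : Tendsto (fun ε : ℝ => C * Real.Gamma (ε + 1)) (𝓝[>] 0) (𝓝 (C * 1)) := by
    have : ContinuousAt (fun ε : ℝ => C * Real.Gamma (ε + 1)) 0 :=
      continuousAt_const.mul (ContinuousAt.comp (f := fun ε : ℝ => ε + 1) (g := Real.Gamma)
        (cont _ (by norm_num)) (by fun_prop))
    have := this.tendsto.mono_left (nhdsWithin_le_nhds (s := Set.Ioi 0))
    simpa using this
  have t2 : Tendsto (fun ε : ℝ => L * ε * Real.Gamma (c + ε)) (𝓝[>] 0) (𝓝 0) := by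
    have : ContinuousAt (fun ε : ℝ => L * ε * Real.Gamma (c + ε)) 0 :=
      ContinuousAt.mul (by fun_prop)
        (ContinuousAt.comp (f := fun ε : ℝ => c + ε) (g := Real.Gamma)
        (cont _ (by simpa using hc)) (by fun_prop))
    have := this.tendsto.mono_left (nhdsWithin_le_nhds (s := Set.Ioi 0))
    simpa using this
  have := le_of_tendsto_of_tendsto t1 t2 (by
    filter_upwards [self_mem_nhdsWithin] with ε hε using key ε hε)
  linarith

lemma simplex_le_one {d : ℕ} (p : Simplex d) (i : Fin (2 * d)) : p.1 i ≤ 1 := by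
  have := Finset.single_le_sum (f := p.1) (fun j _ => p.2.1 j) (Finset.mem_univ i)
  exact this.trans p.2.2.le

lemma measurable_coord {d : ℕ} (i : Fin (2 * d)) : Measurable (fun p : Simplex d => p.1 i) :=
  (measurable_pi_apply i).comp measurable_subtype_coe

/-- The value of the (real) joint moments of the Dirichlet distribution. -/
noncomputable def dval {d : ℕ} (β s : Fin (2 * d) → ℝ) : ℝ :=
  (Real.Gamma (∑ i, β i) / Real.Gamma ((∑ i, β i) + (∑ i, s i))) *
    ∏ i, (Real.Gamma (β i + s i) / Real.Gamma (β i))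

/-- The constant appearing when one isolates the coordinate `i`. -/
noncomputable def dconst {d : ℕ} (β s : Fin (2 * d) → ℝ) (i : Fin (2 * d)) : ℝ :=
  Real.Gamma (∑ j, β j) / Real.Gamma (β i) *
    ∏ j ∈ Finset.univ.erase i, (Real.Gamma (β j + s j) / Real.Gamma (β j))

lemma dval_update {d : ℕ} (β s : Fin (2 * d) → ℝ) (i : Fin (2 * d)) (t : ℝ) :
    dval β (Function.update s i t) = dconst β s i *
      (Real.Gamma (β i + t) /
        Real.Gamma (β i + (∑ j ∈ Finset.univ.erase i, (β j + s j)) + t)) := by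
  have h1 : (∑ j, β j) + ∑ j, Function.update s i t j =
      β i + (∑ j ∈ Finset.univ.erase i, (β j + s j)) + t := by
    rw [← Finset.sum_add_distrib, ← Finset.add_sum_erase _ _ (Finset.mem_univ i),
      Function.update_self]
    have : ∑ j ∈ Finset.univ.erase i, (β j + Function.update s i t j) =
        ∑ j ∈ Finset.univ.erase i, (β j + s j) :=
      Finset.sum_congr rfl fun j hj => by
        rw [Function.update_of_ne (Finset.ne_of_mem_erase hj)]
    rw [this]; ring
  have h2 : ∏ j, (Real.Gamma (β j + Function.update s i t j) / Real.Gamma (β j)) =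
      Real.Gamma (β i + t) / Real.Gamma (β i) *
      ∏ j ∈ Finset.univ.erase i, (Real.Gamma (β j + s j) / Real.Gamma (β j)) := by
    rw [← Finset.mul_prod_erase _ _ (Finset.mem_univ i), Function.update_self]
    congr 1
    exact Finset.prod_congr rfl fun j hj => by
        rw [Function.update_of_ne (Finset.ne_of_mem_erase hj)]
  rw [dval, dconst, h1, h2]
  ring

lemma dconst_pos {d : ℕ} (hd : 1 ≤ d) (β s : Fin (2 * d) → ℝ) (hβ : ∀ i, 0 < β i)
    (i : Fin (2 * d)) (hs : ∀ j, 0 < β j + s j) : 0 < dconst β s i := by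
  have : 0 < ∑ j, β j := Finset.sum_pos (fun j _ => hβ j) ⟨i, Finset.mem_univ i⟩
  refine mul_pos (div_pos (Real.Gamma_pos_of_pos this) (Real.Gamma_pos_of_pos (hβ i)))
    (Finset.prod_pos fun j _ => div_pos (Real.Gamma_pos_of_pos (hs j))
      (Real.Gamma_pos_of_pos (hβ j)))

lemma exists_ne' {d : ℕ} (hd : 1 ≤ d) (i : Fin (2 * d)) : ∃ j, j ≠ i := by
  have : Nontrivial (Fin (2 * d)) := Fin.nontrivial_iff_two_le.2 (by omega)
  exact exists_ne i

lemma rest_pos {d : ℕ} (hd : 1 ≤ d) (β s : Fin (2 * d) → ℝ)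
    (i : Fin (2 * d)) (hs : ∀ j, 0 < β j + s j) :
    0 < ∑ j ∈ Finset.univ.erase i, (β j + s j) := by
  obtain ⟨j, hj⟩ := exists_ne' hd i
  exact Finset.sum_pos (fun j _ => hs j) ⟨j, by simp [hj]⟩

lemma moments_nat {d : ℕ} (β : Fin (2 * d) → ℝ) (μ : Measure (Simplex d))
    (hDir : IsDirichlet d μ β) (k : Fin (2 * d) → ℕ) :
    ∫⁻ p, ∏ j, ENNReal.ofReal (p.1 j ^ ((k j : ℕ) : ℝ)) ∂μ =
      ENNReal.ofReal (dval β fun j => (k j : ℝ)) := by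
  have := hDir.1
  have h := hDir.2 k
  have hnn : ∀ p : Simplex d, 0 ≤ ∏ i, (p.1 i) ^ (k i) :=
    fun p => Finset.prod_nonneg fun i _ => pow_nonneg (p.2.1 i) _
  rw [dval, ← h, ofReal_integral_eq_lintegral_ofReal]
  · refine lintegral_congr fun p => ?_
    rw [ENNReal.ofReal_prod_of_nonneg fun i _ => pow_nonneg (p.2.1 i) _]
    simp
  · refine Integrable.of_bound ?_ 1 (ae_of_all _ fun p => ?_)
    · refine (Finset.measurable_prod _ fun i _ => ?_).aestronglyMeasurable
      exact (measurable_coord i).pow_const _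
    · rw [Real.norm_eq_abs, abs_of_nonneg (hnn p)]
      exact Finset.prod_le_one (fun i _ => pow_nonneg (p.2.1 i) _)
        fun i _ => pow_le_one₀ (p.2.1 i) (simplex_le_one p i)
  · exact ae_of_all _ hnn

lemma tilt {d : ℕ} (μ : Measure (Simplex d)) (s : Fin (2 * d) → ℝ) (i : Fin (2 * d)) (t : ℝ) :
    ∫⁻ p, ENNReal.ofReal (p.1 i ^ t) ∂(μ.withDensity fun p =>
      ∏ j ∈ Finset.univ.erase i, ENNReal.ofReal (p.1 j ^ s j)) =
    ∫⁻ p, ∏ j, ENNReal.ofReal (p.1 j ^ (Function.update s i t j)) ∂μ := by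
  rw [lintegral_withDensity_eq_lintegral_mul]
  · refine lintegral_congr fun p => ?_
    rw [Pi.mul_apply, ← Finset.mul_prod_erase _ _ (Finset.mem_univ i), Function.update_self,
      mul_comm]
    congr 1
    exact Finset.prod_congr rfl fun j hj => by
        rw [Function.update_of_ne (Finset.ne_of_mem_erase hj)]
  · exact Finset.measurable_prod _ fun j _ => ((measurable_coord j).pow_const _).ennreal_ofReal
  · exact ((measurable_coord i).pow_const _).ennreal_ofReal

lemma moments_real {d : ℕ} (hd : 1 ≤ d) (β : Fin (2 * d) → ℝ) (hβ : ∀ i, 0 < β i)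
    (μ : Measure (Simplex d)) (hDir : IsDirichlet d μ β) (S : Finset (Fin (2 * d))) :
    ∀ s : Fin (2 * d) → ℝ, (∀ j, 0 < β j + s j) → (∀ j ∉ S, ∃ k : ℕ, s j = k) →
    ∫⁻ p, ∏ j, ENNReal.ofReal (p.1 j ^ s j) ∂μ = ENNReal.ofReal (dval β s) := by
  induction S using Finset.induction_on with
  | empty =>
    intro s _ hs
    choose k hk using fun j => hs j (by simp)
    have : s = fun j => (k j : ℝ) := funext hk
    subst this
    exact moments_nat β μ hDir k
  | insert i S _ ih =>
    intro s hpos hs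
    have hcoef := rest_pos hd β s i hpos
    have hC := dconst_pos hd β s hβ i hpos
    have := one_dim_moment (μ.withDensity fun p =>
      ∏ j ∈ Finset.univ.erase i, ENNReal.ofReal (p.1 j ^ s j)) (fun p => p.1 i)
      (measurable_coord i) (fun p => p.2.1 i) (fun p => simplex_le_one p i)
      (β i) _ _ (hβ i) hcoef hC ?_ (s i) (hpos i)
    · rw [tilt, ← dval_update, Function.update_eq_self] at this
      exact this
    · intro k
      rw [tilt, ← dval_update]
      refine ih _ ?_ ?_
      · intro j
        by_cases hj : j = i
        · subst hj
          have : (0:ℝ) ≤ k := k.cast_nonneg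
          rw [Function.update_self]; linarith [hβ j]
        · rw [Function.update_of_ne hj]; exact hpos j
      · intro j hjS
        by_cases hj : j = i
        · subst hj
          exact ⟨k, by rw [Function.update_self]⟩
        · rw [Function.update_of_ne hj]; exact hs j (by simp [hj, hjS])

lemma marg_moment {d : ℕ} (β : Fin (2 * d) → ℝ)
    (μ : Measure (Simplex d)) (hDir : IsDirichlet d μ β) (i : Fin (2 * d)) (k : ℕ) :
    ∫⁻ p, ENNReal.ofReal (p.1 i ^ (k:ℝ)) ∂μ = ENNReal.ofReal (dconst β 0 i *
      (Real.Gamma (β i + k) /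
        Real.Gamma (β i + (∑ j ∈ Finset.univ.erase i, (β j + (0 : Fin (2 * d) → ℝ) j)) + k))) := by
  have h := moments_nat β μ hDir (Function.update 0 i k)
  have e : (fun j => ((Function.update (0 : Fin (2 * d) → ℕ) i k j : ℕ) : ℝ)) =
      Function.update (0 : Fin (2 * d) → ℝ) i (k : ℝ) := by
    funext j
    by_cases hj : j = i
    · subst hj; simp
    · simp [Function.update_of_ne hj]
  rw [e, dval_update] at h
  rw [← h]
  refine lintegral_congr fun p => ?_
  rw [← Finset.mul_prod_erase _ _ (Finset.mem_univ i), Function.update_self,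
    Finset.prod_eq_one, mul_one]
  intro j hj
  rw [Function.update_of_ne (Finset.ne_of_mem_erase hj)]
  simp

lemma marg_pos {d : ℕ} (hd : 1 ≤ d) (β : Fin (2 * d) → ℝ) (hβ : ∀ i, 0 < β i)
    (μ : Measure (Simplex d)) (hDir : IsDirichlet d μ β) (i : Fin (2 * d)) :
    ∀ᵐ p ∂μ, 0 < p.1 i := by
  have h0 : ∀ j, 0 < β j + (0 : Fin (2 * d) → ℝ) j := fun j => by simpa using hβ j
  exact one_dim_pos μ (fun p => p.1 i) (measurable_coord i) (fun p => p.2.1 i)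
    (fun p => simplex_le_one p i) (β i) _ _ (hβ i) (rest_pos hd β 0 i h0)
    (dconst_pos hd β 0 hβ i h0) (marg_moment β μ hDir i)

lemma marg_lt {d : ℕ} (hd : 1 ≤ d) (β : Fin (2 * d) → ℝ) (hβ : ∀ i, 0 < β i)
    (μ : Measure (Simplex d)) (hDir : IsDirichlet d μ β) (i : Fin (2 * d)) (s : ℝ)
    (h : ∫⁻ p, ENNReal.ofReal (p.1 i ^ s) ∂μ < ⊤) : 0 < β i + s := by
  have h0 : ∀ j, 0 < β j + (0 : Fin (2 * d) → ℝ) j := fun j => by simpa using hβ j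
  exact one_dim_lt μ (fun p => p.1 i) (measurable_coord i) (fun p => p.2.1 i)
    (fun p => simplex_le_one p i) (β i) _ _ (hβ i) (rest_pos hd β 0 i h0)
    (dconst_pos hd β 0 hβ i h0) (marg_moment β μ hDir i) s h

lemma map_eval {d : ℕ} (ℙ : Measure (Env d)) (μ : Measure (Simplex d))
    (hIID : IsIIDWith d ℙ μ) : ℙ.map (fun ω => ω 0) = μ := by
  ext A hA
  rw [Measure.map_apply (measurable_pi_apply 0) hA]
  have := hIID.2.2 {0} (fun _ => A) (fun _ => hA)
  simp only [Finset.mem_singleton, forall_eq, Finset.prod_singleton] at this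
  exact this

lemma condE_integral {d : ℕ} (ℙ : Measure (Env d)) (μ : Measure (Simplex d))
    (hIID : IsIIDWith d ℙ μ) (α : Fin (2 * d) → ℝ) (i : Fin (2 * d)) :
    ∫⁻ ω, ∏ j ∈ Finset.univ.erase i, ENNReal.ofReal ((ω 0).1 j ^ (-(α j))) ∂ℙ =
    ∫⁻ p, ∏ j ∈ Finset.univ.erase i, ENNReal.ofReal (p.1 j ^ (-(α j))) ∂μ := by
  rw [← map_eval ℙ μ hIID, lintegral_map _ (measurable_pi_apply 0)]
  exact Finset.measurable_prod _ fun j _ => ((measurable_coord j).pow_const _).ennreal_ofReal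

lemma opp_ne {d : ℕ} (hd : 1 ≤ d) (i : Fin (2 * d)) : opp i ≠ i := by
  intro h
  have := congrArg Fin.val h
  have hi := i.isLt
  simp only [opp] at this
  split_ifs at this <;> omega

lemma pair_le {d : ℕ} (hd : 1 ≤ d) (γ : Fin (2 * d) → ℝ) (hγ : ∀ i, 0 ≤ γ i)
    (i : Fin (2 * d)) : γ i + γ (opp i) ≤ ∑ j, γ j := by
  rw [← Finset.sum_pair (f := γ) (opp_ne hd i).symm]
  exact Finset.sum_le_sum_of_subset_of_nonneg (Finset.subset_univ _) fun j _ _ => hγ j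

/-- **Remark (sharp ellipticity condition for Dirichlet environments).**
For the i.i.d. Dirichlet environment with parameters `(β₁,…,β_{2d})` and `β > 0`, the
ellipticity condition `(E')_β` holds if and only if
`2 Σᵢ βᵢ − max_{1≤i≤d}(βᵢ + β_{i+d}) > β`. -/
theorem dirichlet_condE_iff
    (d : ℕ) (hd : 1 ≤ d)
    (β : Fin (2 * d) → ℝ) (hβ : ∀ i, 0 < β i)
    (ℙ : Measure (Env d)) (μ : Measure (Simplex d))
    (hIID : IsIIDWith d ℙ μ) (hDir : IsDirichlet d μ β)
    (b : ℝ) (hb : 0 < b) :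
    CondE d ℙ b ↔ ∀ i : Fin (2 * d), 2 * (∑ j, β j) - (β i + β (opp i)) > b := by
  constructor
  · rintro ⟨α, hα, hsum, hint⟩ i
    have hpos : ∀ᵐ p ∂μ, ∀ j, 0 < p.1 j := ae_all_iff.2 fun j => marg_pos hd β hβ μ hDir j
    have hlt : ∀ j, α j < β j := by
      intro j
      obtain ⟨l, hl⟩ := exists_ne' hd j
      have h1 := hint l
      rw [condE_integral ℙ μ hIID] at h1
      have h2 : ∫⁻ p, ENNReal.ofReal (p.1 j ^ (-(α j))) ∂μ < ⊤ := by
        refine lt_of_le_of_lt (lintegral_mono_ae ?_) h1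
        filter_upwards [hpos] with p hp
        have hj : j ∈ Finset.univ.erase l := by simp [hl.symm]
        rw [← Finset.mul_prod_erase _ _ hj]
        refine le_mul_of_one_le_right' (Finset.one_le_prod' fun m _ => ?_)
        rw [ENNReal.one_le_ofReal]
        exact Real.one_le_rpow_of_pos_of_le_one_of_nonpos (hp m) (simplex_le_one p m)
          (by linarith [hα m])
      have := marg_lt hd β hβ μ hDir j _ h2
      linarith
    have h3 := pair_le hd (fun j => β j - α j) (fun j => by linarith [hlt j]) i
    have h4 : 0 ≤ ∑ j, (β j - α j) := Finset.sum_nonneg fun j _ => by linarith [hlt j]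
    rw [Finset.sum_sub_distrib] at h3 h4
    have := hsum i
    linarith
  · intro h
    have hne : Nonempty (Fin (2 * d)) := ⟨⟨0, by omega⟩⟩
    set B := ∑ j, β j with hB
    have hBpos : 0 < B := Finset.sum_pos (fun j _ => hβ j) Finset.univ_nonempty
    -- scale by `1 - t`
    obtain ⟨t, ht0, ht1, ht⟩ : ∃ t : ℝ, 0 < t ∧ t < 1 ∧
        ∀ i, t * (2 * B - (β i + β (opp i))) > b := by
      obtain ⟨i0, hi0⟩ := Finite.exists_min fun i => 2 * B - (β i + β (opp i))
      have hm := h i0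
      have hmpos : 0 < 2 * B - (β i0 + β (opp i0)) := by linarith
      obtain ⟨t, ht1, ht2⟩ := exists_between ((div_lt_one hmpos).2 hm)
      have ht0 : 0 < t := lt_trans (div_pos hb hmpos) ht1
      refine ⟨t, ht0, ht2, fun i => ?_⟩
      rw [div_lt_iff₀ hmpos] at ht1
      have := mul_le_mul_of_nonneg_left (hi0 i) ht0.le
      linarith
    refine ⟨fun j => t * β j, fun j => mul_pos ht0 (hβ j), fun i => ?_, fun i => ?_⟩
    · rw [← Finset.mul_sum]
      have := ht i
      linarith
    · rw [condE_integral ℙ μ hIID]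
      have hp : ∀ j, 0 < β j + Function.update (fun j => -(t * β j)) i 0 j := by
        intro j
        by_cases hj : j = i
        · subst hj; rw [Function.update_self]; linarith [hβ j]
        · rw [Function.update_of_ne hj]; nlinarith [hβ j]
      have := moments_real hd β hβ μ hDir Finset.univ _ hp (by simp)
      refine lt_of_eq_of_lt ?_ (this ▸ ENNReal.ofReal_lt_top)
      refine lintegral_congr fun p => ?_
      rw [← Finset.mul_prod_erase _ _ (Finset.mem_univ i), Function.update_self,
        Real.rpow_zero, ENNReal.ofReal_one, one_mul]
      exact Finset.prod_congr rfl fun j hj => by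
        rw [Function.update_of_ne (Finset.ne_of_mem_erase hj)]

end RWRE
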